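/- Let A be a regular local ring of dimension p with maximal ideal 𝔪, and let A[ε] be its ring of dual numbers. Let I′ be an ideal of A[ε] such that the image of I′ under the reduction map A[ε] → A (sending ε to 0) equals 𝔪, and such that I′ ∩ εA[ε] = εI′. Then there exist a regular sequence f₁, …, f_p generating 𝔪 and elements g₁, …, g_p ∈ A such that I′ = (f₁ + εg₁, …, f_p + εg_p), and moreover f₁ + εg₁, …, f_p + εg_p is a regular sequence in A[ε]. -/

import Mathlib

open DualNumber TrivSqZeroExt

section RegularLocal

open IsLocalRing

theorem ringKrullDim_le_length_of_ofList_eq_maximalIdeal {R : Type*} [CommRing R] [IsLocalRing R]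
    [IsNoetherianRing R] {rs : List R} (hrs : Ideal.ofList rs = maximalIdeal R) :
    ringKrullDim R ≤ rs.length := by
  classical
  refine (ringKrullDim_le_spanFinrank_maximalIdeal R).trans ?_
  rw [← hrs]
  have h := Submodule.spanFinrank_span_le_ncard_of_finite (R := R) (rs.toFinset.finite_toSet)
  rw [Set.ncard_coe_finset] at h
  have e : Ideal.ofList rs = Submodule.span R (rs.toFinset : Set R) := by
    simp [Ideal.ofList, Ideal.span]
  rw [e]
  exact_mod_cast h.trans rs.toFinset_card_le

theorem ofList_map_mk_eq_maximalIdeal_quotient {R : Type*} [CommRing R] [IsLocalRing R] {x : R}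
    {rs : List R} (hrs : Ideal.ofList (x :: rs) = maximalIdeal R)
    [IsLocalRing (R ⧸ Ideal.span {x})] :
    Ideal.ofList (rs.map (Ideal.Quotient.mk (Ideal.span {x}))) =
      maximalIdeal (R ⧸ Ideal.span {x}) := by
  rw [← map_maximalIdeal_of_surjective _ (Ideal.Quotient.mk_surjective (I := Ideal.span {x})), ← hrs,
    Ideal.ofList_cons, Ideal.map_sup, Ideal.map_quotient_self, bot_sup_eq,
    Ideal.map_ofList]

theorem isLocalRing_quotient_span_singleton {R : Type*} [CommRing R] [IsLocalRing R] {x : R}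
    (hx : x ∈ maximalIdeal R) : IsLocalRing (R ⧸ Ideal.span {x}) := by
  have : Nontrivial (R ⧸ Ideal.span {x}) := Ideal.Quotient.nontrivial_iff.2 fun h =>
    (mem_maximalIdeal x).1 hx (Ideal.span_singleton_eq_top.1 h)
  exact .of_surjective' (Ideal.Quotient.mk _) Ideal.Quotient.mk_surjective

theorem natCast_le_ringKrullDim_quotient_span_singleton {R : Type*} [CommRing R] [IsLocalRing R]
    [IsNoetherianRing R] {x : R} (hx : x ∈ maximalIdeal R) {n : ℕ}
    (hdim : ((n + 1 : ℕ) : WithBot ℕ∞) ≤ ringKrullDim R) :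
    (n : WithBot ℕ∞) ≤ ringKrullDim (R ⧸ Ideal.span {x}) := by
  have h := hdim.trans (ringKrullDim_le_ringKrullDim_quotient_add_card {x}
    (by simpa [ringJacobson_eq_maximalIdeal] using hx))
  rw [Finset.coe_singleton, Finset.card_singleton, Nat.cast_add] at h
  exact ENat.WithBot.add_le_add_natCast_right_iff.1 h

/-- By prime avoidance, one generator of a minimal generating list of the maximal ideal can be
replaced by an element outside all minimal primes. -/
theorem exists_cons_generators_notMem_minimalPrimes {R : Type*} [CommRing R] [IsLocalRing R]
    [IsNoetherianRing R] {r : R} {rs : List R} (hrs : Ideal.ofList (r :: rs) = maximalIdeal R)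
    (hdim : ((r :: rs).length : WithBot ℕ∞) ≤ ringKrullDim R) :
    ∃ x, Ideal.ofList (x :: rs) = maximalIdeal R ∧ ∀ q ∈ minimalPrimes R, x ∉ q := by
  set J := Ideal.ofList rs ⊔ maximalIdeal R • maximalIdeal R with hJ
  have hjac : maximalIdeal R ≤ Ideal.jacobson ⊥ := maximalIdeal_le_jacobson _
  have hle : Ideal.ofList rs ≤ maximalIdeal R := by
    rw [← hrs, Ideal.ofList_cons]; exact le_sup_right
  have hfin : (insert J (minimalPrimes R)).Finite :=
    (minimalPrimes.finite_of_isNoetherianRing R).insert J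
  have hnot : ¬ ((maximalIdeal R : Set R) ⊆
      ⋃ i ∈ insert J (minimalPrimes R), ((id i : Ideal R) : Set R)) := by
    rw [Ideal.subset_union_prime_finite hfin J J (by
      rintro i (rfl | hi) h _
      · exact absurd rfl h
      · exact hi.1.1)]
    rintro ⟨i, rfl | hi, him⟩
    · have := le_antisymm hle (Submodule.le_of_le_smul_of_le_jacobson_bot
        (IsNoetherian.noetherian _) hjac him)
      have h2 := hdim.trans (ringKrullDim_le_length_of_ofList_eq_maximalIdeal this)
      have h3 : (r :: rs).length ≤ rs.length := by exact_mod_cast h2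
      simp at h3
    · have : i.IsPrime := hi.1.1
      have hi' : i = maximalIdeal R := le_antisymm (le_maximalIdeal this.ne_top) him
      have h0 : (maximalIdeal R).height = 0 := by
        rw [Ideal.height_eq_zero_iff]; exact hi' ▸ hi
      rw [← maximalIdeal_height_eq_ringKrullDim, h0] at hdim
      have h3 : (r :: rs).length ≤ 0 := by exact_mod_cast hdim
      simp at h3
  obtain ⟨x, hxm, hx⟩ := Set.not_subset.1 hnot
  simp only [id, Set.mem_iUnion, not_exists, Set.mem_insert_iff, SetLike.mem_coe] at hx
  refine ⟨x, le_antisymm ?_ ?_, fun q hq => hx q (Or.inr hq)⟩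
  · rw [Ideal.ofList_cons]
    exact sup_le ((Ideal.span_singleton_le_iff_mem _).2 hxm) hle
  · refine Submodule.le_of_le_smul_of_le_jacobson_bot (IsNoetherian.noetherian _) hjac ?_
    have hxJ := hx J (Or.inl rfl)
    have hxm' : x ∈ maximalIdeal R := hxm
    rw [← hrs, Ideal.ofList_cons, Submodule.mem_sup] at hxm'
    obtain ⟨y, hy, z, hz, hyz⟩ := hxm'
    obtain ⟨u, rfl⟩ := Ideal.mem_span_singleton'.1 hy
    have hr : r ∈ maximalIdeal R := by
      rw [← hrs, Ideal.ofList_cons]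
      exact Ideal.mem_sup_left (Ideal.mem_span_singleton_self r)
    have hu : IsUnit u := by
      by_contra hu
      exact hxJ (hyz ▸ J.add_mem (Ideal.mem_sup_right (Submodule.smul_mem_smul hu hr))
        (Ideal.mem_sup_left hz))
    have hmem : r ∈ Ideal.ofList (x :: rs) := by
      rw [Ideal.ofList_cons, ← Ideal.unit_mul_mem_iff_mem _ hu, ← add_sub_cancel_right (u * r) z,
        hyz]
      exact Ideal.sub_mem _ (Ideal.mem_sup_left (Ideal.mem_span_singleton_self x))
        (Ideal.mem_sup_right hz)
    refine le_trans ?_ le_sup_left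
    conv_lhs => rw [← hrs, Ideal.ofList_cons]
    refine sup_le ((Ideal.span_singleton_le_iff_mem _).2 hmem) ?_
    rw [Ideal.ofList_cons]
    exact le_sup_right

theorem isDomain_of_ofList_eq_maximalIdeal {n : ℕ} {R : Type*} [CommRing R] [IsLocalRing R]
    [IsNoetherianRing R] {rs : List R} (hrs : Ideal.ofList rs = maximalIdeal R)
    (hlen : rs.length = n) (hdim : (n : WithBot ℕ∞) ≤ ringKrullDim R) : IsDomain R := by
  induction n generalizing R with
  | zero =>
    rw [List.length_eq_zero_iff] at hlen
    subst hlen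
    exact (isField_iff_maximalIdeal_eq.2 (by simpa using hrs.symm)).isDomain
  | succ n ih =>
    obtain ⟨r, t, rfl⟩ := List.exists_cons_of_length_eq_add_one hlen
    obtain ⟨x, hx, hxq⟩ := exists_cons_generators_notMem_minimalPrimes hrs (by rwa [hlen])
    have hxm : x ∈ maximalIdeal R := by
      rw [← hx, Ideal.ofList_cons]
      exact Ideal.mem_sup_left (Ideal.mem_span_singleton_self x)
    have := isLocalRing_quotient_span_singleton hxm
    have hq := ih (ofList_map_mk_eq_maximalIdeal_quotient hx) (by simpa using hlen)
      (natCast_le_ringKrullDim_quotient_span_singleton hxm hdim)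
    have hp : (Ideal.span {x}).IsPrime := (Ideal.Quotient.isDomain_iff_prime _).1 hq
    obtain ⟨q, hqm, hqx⟩ := Ideal.exists_minimalPrimes_le (I := ⊥) (J := Ideal.span {x}) bot_le
    have hqp : q.IsPrime := hqm.1.1
    have hbot : q = ⊥ := by
      refine Submodule.eq_bot_of_le_smul_of_le_jacobson_bot (maximalIdeal R) q
        (IsNoetherian.noetherian _) (fun y hy => ?_) (maximalIdeal_le_jacobson _)
      obtain ⟨a, rfl⟩ := Ideal.mem_span_singleton'.1 (hqx hy)
      have ha := (hqp.mem_or_mem hy).resolve_right (hxq q hqm)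
      rw [mul_comm]
      exact Submodule.smul_mem_smul hxm ha
    have := (Ideal.Quotient.isDomain_iff_prime (⊥ : Ideal R)).2 (hbot ▸ hqp)
    exact (RingEquiv.quotientBot R).symm.isDomain

open scoped Pointwise in
theorem isWeaklyRegular_of_ofList_eq_maximalIdeal {n : ℕ} {R : Type*} [CommRing R] [IsLocalRing R]
    [IsNoetherianRing R] {rs : List R} (hrs : Ideal.ofList rs = maximalIdeal R)
    (hlen : rs.length = n) (hdim : (n : WithBot ℕ∞) ≤ ringKrullDim R) :
    RingTheory.Sequence.IsWeaklyRegular R rs := by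
  induction n generalizing R with
  | zero =>
    rw [List.length_eq_zero_iff] at hlen
    subst hlen
    exact .nil R R
  | succ n ih =>
    have := isDomain_of_ofList_eq_maximalIdeal hrs hlen hdim
    obtain ⟨x, t, rfl⟩ := List.exists_cons_of_length_eq_add_one hlen
    have hxm : x ∈ maximalIdeal R := by
      rw [← hrs, Ideal.ofList_cons]
      exact Ideal.mem_sup_left (Ideal.mem_span_singleton_self x)
    have := isLocalRing_quotient_span_singleton hxm
    have hq := ih (ofList_map_mk_eq_maximalIdeal_quotient hrs) (by simpa using hlen)
      (natCast_le_ringKrullDim_quotient_span_singleton hxm hdim)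
    have hx0 : x ≠ 0 := by
      rintro rfl
      have h1 : Ideal.ofList t = maximalIdeal R := by simpa using hrs
      have h2 := hdim.trans (ringKrullDim_le_length_of_ofList_eq_maximalIdeal h1)
      have h3 : n + 1 ≤ t.length := by exact_mod_cast h2
      simp at hlen
      omega
    rw [RingTheory.Sequence.isWeaklyRegular_cons_iff]
    refine ⟨.of_ne_zero hx0, ?_⟩
    have e : x • (⊤ : Submodule R R) = Ideal.span {x} := by
      simp [← Submodule.ideal_span_singleton_smul]
    rw [(Submodule.quotEquivOfEq _ _ e).isWeaklyRegular_congr]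
    exact (RingTheory.Sequence.isWeaklyRegular_map_algebraMap_iff (R ⧸ Ideal.span {x}) _ t).1 hq


end RegularLocal

theorem isWeaklyRegular_ofFn_iff {R : Type*} [CommRing R] {n : ℕ} {f : Fin n → R} :
    RingTheory.Sequence.IsWeaklyRegular R (List.ofFn f) ↔
      ∀ i : Fin n, ∀ z, f i * z ∈ Ideal.ofList ((List.ofFn f).take i) →
        z ∈ Ideal.ofList ((List.ofFn f).take i) := by
  rw [RingTheory.Sequence.isWeaklyRegular_iff]
  simp only [isSMulRegular_quotient_iff_mem_of_smul_mem, smul_eq_mul, Ideal.mul_top,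
    List.getElem_ofFn, List.length_ofFn]
  exact ⟨fun h i => h i i.2, fun h i hi => h ⟨i, hi⟩⟩

/-- `J'` is a first-order embedded deformation of `J`: it reduces to `J`, and
`J' ∩ εA[ε] = εJ`. -/
structure IsFirstOrderDeformation {A : Type*} [CommRing A] (J' : Ideal (DualNumber A))
    (J : Ideal A) : Prop where
  fst_mem : ∀ z ∈ J', z.fst ∈ J
  exists_lift : ∀ c ∈ J, ∃ z ∈ J', z.fst = c
  mem_of_inr_mem : ∀ c : A, (inr c : DualNumber A) ∈ J' → c ∈ J

namespace IsFirstOrderDeformation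

variable {A : Type*} [CommRing A] {J' : Ideal (DualNumber A)} {J : Ideal A}

theorem inr_mem (h : IsFirstOrderDeformation J' J) {c : A} (hc : c ∈ J) :
    (inr c : DualNumber A) ∈ J' := by
  obtain ⟨z, hz, rfl⟩ := h.exists_lift c hc
  have : (inr z.fst : DualNumber A) = ε * z := by
    ext <;> simp [DualNumber.fst_eps, DualNumber.snd_eps]
  exact this ▸ J'.mul_mem_left _ hz

theorem bot : IsFirstOrderDeformation (⊥ : Ideal (DualNumber A)) ⊥ where
  fst_mem := by simp
  exists_lift := by simp
  mem_of_inr_mem c hc := by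
    simpa [-DualNumber.inr_eq_smul_eps] using congrArg snd (Ideal.mem_bot.1 hc)

/-- Reduction to the `ε`-part: an element with reduction in `J` differs from an element of `J'`
by a multiple of `ε`. -/
theorem exists_eq_add_inr (h : IsFirstOrderDeformation J' J) {z : DualNumber A}
    (hz : z.fst ∈ J) : ∃ y ∈ J', ∃ w : A, z = y + inr w := by
  obtain ⟨y, hy, hyz⟩ := h.exists_lift _ hz
  exact ⟨y, hy, z.snd - y.snd, by ext <;> simp [hyz]⟩

theorem mem_of_mul_mem (h : IsFirstOrderDeformation J' J) {F : DualNumber A}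
    (hF : ∀ c, F.fst * c ∈ J → c ∈ J) {z : DualNumber A} (hz : F * z ∈ J') : z ∈ J' := by
  obtain ⟨y, hy, w, rfl⟩ := h.exists_eq_add_inr (hF z.fst (by simpa using h.fst_mem _ hz))
  refine J'.add_mem hy (h.inr_mem (hF w (h.mem_of_inr_mem _ ?_)))
  have : (inr (F.fst * w) : DualNumber A) = F * (y + inr w) - F * y := by
    ext <;> simp [mul_add, mul_comm]
  exact this ▸ J'.sub_mem hz (J'.mul_mem_left _ hy)

theorem sup_span_singleton (h : IsFirstOrderDeformation J' J) {F : DualNumber A}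
    (hF : ∀ c, F.fst * c ∈ J → c ∈ J) :
    IsFirstOrderDeformation (J' ⊔ Ideal.span {F}) (J ⊔ Ideal.span {F.fst}) where
  fst_mem z hz := by
    rw [sup_comm, Ideal.mem_span_singleton_sup] at hz ⊢
    obtain ⟨v, y, hy, rfl⟩ := hz
    exact ⟨v.fst, y.fst, h.fst_mem y hy, by simp⟩
  exists_lift c hc := by
    rw [sup_comm, Ideal.mem_span_singleton_sup] at hc
    obtain ⟨a, b, hb, rfl⟩ := hc
    obtain ⟨y, hy, rfl⟩ := h.exists_lift b hb
    rw [sup_comm]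
    exact ⟨inl a * F + y, Ideal.mem_span_singleton_sup.2 ⟨_, y, hy, rfl⟩, by simp⟩
  mem_of_inr_mem c hc := by
    rw [sup_comm, Ideal.mem_span_singleton_sup] at hc ⊢
    obtain ⟨v, y, hy, hvy⟩ := hc
    have hv : F.fst * v.fst = -y.fst := by
      rw [eq_neg_iff_add_eq_zero, mul_comm]
      simpa using congrArg fst hvy
    obtain ⟨u, hu, w, rfl⟩ := h.exists_eq_add_inr (hF _ (hv ▸ J.neg_mem (h.fst_mem y hy)))
    refine ⟨w, c - w * F.fst, h.mem_of_inr_mem _ ?_, by ring⟩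
    have : (inr (c - w * F.fst) : DualNumber A) = u * F + y := by
      rw [inr_sub, ← hvy]
      ext
      · simp [mul_comm]
      · simp [mul_comm]
        ring
    exact this ▸ J'.add_mem (J'.mul_mem_right _ hu) hy

end IsFirstOrderDeformation

theorem isFirstOrderDeformation_ofList_take {A : Type*} [CommRing A] {n : ℕ}
    {F : Fin n → DualNumber A}
    (hf : RingTheory.Sequence.IsWeaklyRegular A (List.ofFn fun i => (F i).fst)) {k : ℕ}
    (hk : k ≤ n) :
    IsFirstOrderDeformation (Ideal.ofList ((List.ofFn F).take k))
      (Ideal.ofList ((List.ofFn fun i => (F i).fst).take k)) := by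
  induction k with
  | zero => simpa using .bot
  | succ k ih =>
    have := (ih (by omega)).sup_span_singleton (isWeaklyRegular_ofFn_iff.1 hf ⟨k, hk⟩)
    rw [List.take_add_one, List.take_add_one, Ideal.ofList_append, Ideal.ofList_append]
    simpa [show k < n from hk] using this

theorem isWeaklyRegular_ofFn_of_fst {A : Type*} [CommRing A] {n : ℕ} {F : Fin n → DualNumber A}
    (hf : RingTheory.Sequence.IsWeaklyRegular A (List.ofFn fun i => (F i).fst)) :
    RingTheory.Sequence.IsWeaklyRegular (DualNumber A) (List.ofFn F) :=
  isWeaklyRegular_ofFn_iff.2 fun i _ hz =>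
    (isFirstOrderDeformation_ofList_take hf i.2.le).mem_of_mul_mem
      (isWeaklyRegular_ofFn_iff.1 hf i) hz

/-- Let `A` be a regular local ring of dimension `p` (i.e. a Noetherian local
ring of Krull dimension `p` whose maximal ideal is generated by `p` elements), and let `A[ε]`
be its ring of dual numbers.  Let `I'` be an ideal of `A[ε]` such that the image of `I'` under
the reduction map `A[ε] → A` equals the maximal ideal `𝔪`, and such that `I' ∩ εA[ε] = εI'`.
Then there exist a regular sequence `f₁, …, f_p` generating `𝔪` and elements
`g₁, …, g_p ∈ A` such that `I' = (f₁ + εg₁, …, f_p + εg_p)`, and moreover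
`f₁ + εg₁, …, f_p + εg_p` is a regular sequence in `A[ε]`. -/
theorem stmt3 (A : Type*) [CommRing A] [IsLocalRing A] [IsNoetherianRing A] (p : ℕ)
    (hdim : ringKrullDim A = p)
    (hregular : ∃ s : Finset A, s.card = p ∧
      Ideal.span (s : Set A) = IsLocalRing.maximalIdeal A)
    (I' : Ideal (DualNumber A))
    (hred : I'.map (TrivSqZeroExt.fstHom A A A : DualNumber A →ₐ[A] A).toRingHom
      = IsLocalRing.maximalIdeal A)
    (hflat : ∀ x : DualNumber A,
      x ∈ I' ⊓ Ideal.span {(ε : DualNumber A)} ↔ ∃ y ∈ I', x = ε * y) :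
    ∃ f g : Fin p → A,
      RingTheory.Sequence.IsRegular A (List.ofFn f) ∧
      Ideal.span (Set.range f) = IsLocalRing.maximalIdeal A ∧
      I' = Ideal.span (Set.range fun i =>
        algebraMap A (DualNumber A) (f i) + ε * algebraMap A (DualNumber A) (g i)) ∧
      RingTheory.Sequence.IsRegular (DualNumber A)
        (List.ofFn fun i =>
          algebraMap A (DualNumber A) (f i) + ε * algebraMap A (DualNumber A) (g i)) := by
  obtain ⟨s, hs, hspan⟩ := hregular
  let f : Fin p → A := fun i => (s.equivFinOfCardEq hs).symm i
  have hrange : Set.range f = s := by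
    rw [show f = Subtype.val ∘ (s.equivFinOfCardEq hs).symm from rfl, EquivLike.range_comp]
    simp
  have hof : Ideal.ofList (List.ofFn f) = IsLocalRing.maximalIdeal A := by
    rw [← hspan, ← hrange]
    simp [Ideal.ofList, List.mem_ofFn, Set.range]
  have hfm : Ideal.span (Set.range f) = IsLocalRing.maximalIdeal A := by rw [hrange, hspan]
  have hf : RingTheory.Sequence.IsWeaklyRegular A (List.ofFn f) :=
    isWeaklyRegular_of_ofList_eq_maximalIdeal hof (by simp) hdim.ge
  have hmem : ∀ a, a ∈ IsLocalRing.maximalIdeal A ↔ ∃ z ∈ I', z.fst = a := fun a => by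
    rw [← hred]
    exact Ideal.mem_map_iff_of_surjective _ fst_surjective
  have hfi : ∀ i, f i ∈ IsLocalRing.maximalIdeal A := fun i =>
    hfm ▸ Ideal.subset_span (Set.mem_range_self i)
  choose z hzI hzf using fun i => (hmem (f i)).1 (hfi i)
  have hF : (fun i => algebraMap A (DualNumber A) (f i) +
      ε * algebraMap A (DualNumber A) (z i).snd) = z := by
    funext i
    ext <;> simp [hzf, algebraMap_eq_inl]
  have hfz : (fun i => (z i).fst) = f := funext hzf
  have hlift : ∀ a ∈ IsLocalRing.maximalIdeal A, ∃ y ∈ Ideal.span (Set.range z), y.fst = a := by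
    intro a ha
    rw [← hfm, Ideal.mem_span_range_iff_exists_fun] at ha
    obtain ⟨c, rfl⟩ := ha
    refine ⟨∑ i, inl (c i) * z i, Ideal.sum_mem _ fun i _ =>
      Ideal.mul_mem_left _ _ (Ideal.subset_span (Set.mem_range_self i)), ?_⟩
    exact (map_sum (fstHom A A A) _ _).trans (by simp [hzf])
  have hle : Ideal.span (Set.range z) ≤ I' := by
    rw [Ideal.span_le]
    rintro _ ⟨i, rfl⟩
    exact hzI i
  refine ⟨f, fun i => (z i).snd, .of_isWeaklyRegular_of_mem_maximalIdeal A ?_ hf, hfm, ?_, ?_⟩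
  · simpa [List.mem_ofFn] using hfi
  · rw [hF]
    refine le_antisymm (fun x hx => ?_) hle
    obtain ⟨y, hy, hyx⟩ := hlift _ ((hmem _).2 ⟨x, hx, rfl⟩)
    have hε : x - y = ε * inl (x - y).snd := by
      ext <;> simp [hyx]
    obtain ⟨v, hv, hxv⟩ := (hflat (x - y)).1
      ⟨I'.sub_mem hx (hle hy), hε ▸ Ideal.mul_mem_right _ _ (Ideal.mem_span_singleton_self _)⟩
    obtain ⟨u, hu, huv⟩ := hlift _ ((hmem _).2 ⟨v, hv, rfl⟩)
    have hvu : (ε : DualNumber A) * v = ε * u := by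
      ext <;> simp [huv]
    rw [← sub_add_cancel x y, hxv, hvu]
    exact Ideal.add_mem _ (Ideal.mul_mem_left _ _ hu) hy
  · rw [hF]
    refine ⟨isWeaklyRegular_ofFn_of_fst (by rwa [hfz]), fun htop => ?_⟩
    have h1 : (1 : DualNumber A) ∈ Ideal.ofList (List.ofFn z) := by
      rw [← Ideal.mul_top (Ideal.ofList _), ← smul_eq_mul, ← htop]
      trivial
    have h2 : Ideal.ofList (List.ofFn z) = Ideal.span (Set.range z) := by
      simp [Ideal.ofList, List.mem_ofFn, Set.range]
    exact (IsLocalRing.maximalIdeal.isMaximal A).ne_top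
      ((Ideal.eq_top_iff_one _).2 ((hmem 1).2 ⟨1, hle (h2 ▸ h1), by simp⟩))
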